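/- arXiv:1406.0299 — 2 statements merged into one kernel-verified Lean document; each statement's English description precedes it below -/
import Mathlib

section
/- With B, C and E a regular separability idempotent with antipodal maps S_B, S_C as in the context, set F₁ = (id_B ⊗ S_C)(E) and F₃ = (id_B ⊗ S_B⁻¹)(E), elements of B ⊗ B, and F₂ = (S_B ⊗ id_C)(E) and F₄ = (S_C⁻¹ ⊗ id_C)(E), elements of C ⊗ C. Let E₁₃ denote, in B ⊗ B ⊗ C (respectively in B ⊗ C ⊗ C), the image of E under the linear map determined by b ⊗ c ↦ b ⊗ 1 ⊗ c. Then in B ⊗ B ⊗ C: E₁₃·(F₁ ⊗ 1) = E₁₃·(1 ⊗ E) and (F₃ ⊗ 1)·E₁₃ = (1 ⊗ E)·E₁₃; and in B ⊗ C ⊗ C: (1 ⊗ F₂)·E₁₃ = (E ⊗ 1)·E₁₃ and E₁₃·(1 ⊗ F₄) = E₁₃·(E ⊗ 1). -/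
open TensorProduct

/-- Slice map `id ⊗ ω` landing in the left tensor factor. -/
noncomputable def sL {B C : Type} [AddCommGroup B] [Module ℂ B] [AddCommGroup C] [Module ℂ C]
    (ω : C →ₗ[ℂ] ℂ) : (B ⊗[ℂ] C) →ₗ[ℂ] B :=
  (TensorProduct.rid ℂ B).toLinearMap ∘ₗ LinearMap.lTensor B ω

/-- Slice map `ω ⊗ id` landing in the right tensor factor. -/
noncomputable def sR {B C : Type} [AddCommGroup B] [Module ℂ B] [AddCommGroup C] [Module ℂ C]
    (ω : B →ₗ[ℂ] ℂ) : (B ⊗[ℂ] C) →ₗ[ℂ] C :=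
  (TensorProduct.lid ℂ C).toLinearMap ∘ₗ LinearMap.rTensor C ω

section SeparabilityIdempotent

variable {B C D : Type} [Ring B] [Algebra ℂ B] [Ring C] [Algebra ℂ C] [Ring D] [Algebra ℂ D]

/-- The map `b ⊗ c ↦ b ⊗ 1 ⊗ c` is multiplicative. -/
theorem map_id_mk_one_mul (X Y : B ⊗[ℂ] C) :
    TensorProduct.map LinearMap.id (TensorProduct.mk ℂ D C 1) (X * Y) =
      TensorProduct.map LinearMap.id (TensorProduct.mk ℂ D C 1) X *
        TensorProduct.map LinearMap.id (TensorProduct.mk ℂ D C 1) Y :=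
  map_mul (Algebra.TensorProduct.map (AlgHom.id ℂ B)
    (Algebra.TensorProduct.includeRight : C →ₐ[ℂ] D ⊗[ℂ] C)) X Y

/-- A right exchange relation for `E` passes to `E₁₃`. -/
theorem map_id_mk_one_mul_exchange {E : B ⊗[ℂ] C} {b : B} {c : C}
    (h : E * (b ⊗ₜ[ℂ] (1 : C)) = E * ((1 : B) ⊗ₜ[ℂ] c)) (x : D) :
    TensorProduct.map LinearMap.id (TensorProduct.mk ℂ D C 1) E * (b ⊗ₜ[ℂ] (x ⊗ₜ[ℂ] (1 : C))) =
      TensorProduct.map LinearMap.id (TensorProduct.mk ℂ D C 1) E *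
        ((1 : B) ⊗ₜ[ℂ] (x ⊗ₜ[ℂ] c)) := by
  have h' := congrArg (fun Z => TensorProduct.map LinearMap.id (TensorProduct.mk ℂ D C 1) Z *
    ((1 : B) ⊗ₜ[ℂ] (x ⊗ₜ[ℂ] (1 : C)))) h
  simpa [map_id_mk_one_mul, mul_assoc] using h'

/-- A left exchange relation for `E` passes to `E₁₃`. -/
theorem exchange_mul_map_id_mk_one {E : B ⊗[ℂ] C} {b : B} {c : C}
    (h : ((1 : B) ⊗ₜ[ℂ] c) * E = (b ⊗ₜ[ℂ] (1 : C)) * E) (x : D) :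
    ((1 : B) ⊗ₜ[ℂ] (x ⊗ₜ[ℂ] c)) * TensorProduct.map LinearMap.id (TensorProduct.mk ℂ D C 1) E =
      (b ⊗ₜ[ℂ] (x ⊗ₜ[ℂ] (1 : C))) *
        TensorProduct.map LinearMap.id (TensorProduct.mk ℂ D C 1) E := by
  have h' := congrArg (fun Z => ((1 : B) ⊗ₜ[ℂ] (x ⊗ₜ[ℂ] (1 : C))) *
    TensorProduct.map LinearMap.id (TensorProduct.mk ℂ D C 1) Z) h
  simpa [map_id_mk_one_mul, ← mul_assoc] using h'

theorem sL_tmul_one_mul (ω : C →ₗ[ℂ] ℂ) (X : B ⊗[ℂ] C) (b : B) :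
    sL ω ((b ⊗ₜ[ℂ] (1 : C)) * X) = b * sL ω X := by
  induction X with
  | zero => simp
  | tmul a d => simp [sL]
  | add X Y hX hY => rw [mul_add, map_add, map_add, mul_add, hX, hY]

/-- Left multiplication of the first leg of a left-full tensor is faithful. -/
theorem eq_one_of_tmul_one_mul_eq_self {E : B ⊗[ℂ] C}
    (hfull : Submodule.span ℂ {x : B | ∃ ω : C →ₗ[ℂ] ℂ, x = sL ω E} = ⊤) {b : B}
    (h : (b ⊗ₜ[ℂ] (1 : C)) * E = E) : b = 1 := by
  have key : LinearMap.mulLeft ℂ b = LinearMap.id := by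
    refine LinearMap.ext_on hfull ?_
    rintro _ ⟨ω, rfl⟩
    simp [← sL_tmul_one_mul, h]
  simpa using LinearMap.congr_fun key 1

/-- The linear map `b ⊗ c ↦ S b * c`. -/
noncomputable def mulMapLeft (S : B →ₗ[ℂ] C) : B ⊗[ℂ] C →ₗ[ℂ] C :=
  LinearMap.mul' ℂ C ∘ₗ TensorProduct.map S LinearMap.id

/-- The linear map `b ⊗ c ↦ b * S c`. -/
noncomputable def mulMapRight (S : C →ₗ[ℂ] B) : B ⊗[ℂ] C →ₗ[ℂ] B :=
  LinearMap.mul' ℂ B ∘ₗ TensorProduct.map LinearMap.id S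

/-- The linear map `b ⊗ c ↦ S' c ⊗ S b`. -/
noncomputable def flipMap (S : B →ₗ[ℂ] C) (S' : C →ₗ[ℂ] B) : B ⊗[ℂ] C →ₗ[ℂ] B ⊗[ℂ] C :=
  TensorProduct.map S' S ∘ₗ (TensorProduct.comm ℂ B C).toLinearMap

@[simp]
theorem mulMapLeft_tmul (S : B →ₗ[ℂ] C) (b : B) (c : C) :
    mulMapLeft S (b ⊗ₜ[ℂ] c) = S b * c := rfl

@[simp]
theorem mulMapRight_tmul (S : C →ₗ[ℂ] B) (b : B) (c : C) :
    mulMapRight S (b ⊗ₜ[ℂ] c) = b * S c := rfl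

@[simp]
theorem flipMap_tmul (S : B →ₗ[ℂ] C) (S' : C →ₗ[ℂ] B) (b : B) (c : C) :
    flipMap S S' (b ⊗ₜ[ℂ] c) = S' c ⊗ₜ[ℂ] S b := rfl

theorem flipMap_mul {S : B →ₗ[ℂ] C} {S' : C →ₗ[ℂ] B}
    (hS : ∀ b b' : B, S (b * b') = S b' * S b) (hS' : ∀ c c' : C, S' (c * c') = S' c' * S' c)
    (X Y : B ⊗[ℂ] C) : flipMap S S' (X * Y) = flipMap S S' Y * flipMap S S' X := by
  induction X with
  | zero => simp
  | add X X' hX hX' => rw [add_mul, map_add, map_add, mul_add, hX, hX']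
  | tmul b c =>
    induction Y with
    | zero => simp
    | add Y Y' hY hY' => rw [mul_add, map_add, map_add, add_mul, hY, hY']
    | tmul b' c' => simp [hS, hS']

theorem mul_eq_mul_one_tmul_mulMapLeft {E : B ⊗[ℂ] C} {S : B →ₗ[ℂ] C}
    (h : ∀ b : B, E * (b ⊗ₜ[ℂ] (1 : C)) = E * ((1 : B) ⊗ₜ[ℂ] S b)) (X : B ⊗[ℂ] C) :
    E * X = E * ((1 : B) ⊗ₜ[ℂ] mulMapLeft S X) := by
  induction X with
  | zero => simp
  | add X Y hX hY => rw [mul_add, map_add, TensorProduct.tmul_add, mul_add, hX, hY]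
  | tmul b c =>
    have h' := congrArg (· * ((1 : B) ⊗ₜ[ℂ] c)) (h b)
    simpa [mul_assoc] using h'

theorem mul_eq_mulMapRight_tmul_one_mul {E : B ⊗[ℂ] C} {S : C →ₗ[ℂ] B}
    (h : ∀ c : C, ((1 : B) ⊗ₜ[ℂ] c) * E = (S c ⊗ₜ[ℂ] (1 : C)) * E) (X : B ⊗[ℂ] C) :
    X * E = (mulMapRight S X ⊗ₜ[ℂ] (1 : C)) * E := by
  induction X with
  | zero => simp
  | add X Y hX hY => rw [add_mul, map_add, TensorProduct.add_tmul, add_mul, hX, hY]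
  | tmul b c =>
    have h' := congrArg ((b ⊗ₜ[ℂ] (1 : C)) * ·) (h c)
    simpa [← mul_assoc] using h'

theorem mulMapLeft_flipMap {S : B →ₗ[ℂ] C} {S' : C →ₗ[ℂ] B}
    (hS : ∀ b b' : B, S (b * b') = S b' * S b) (X : B ⊗[ℂ] C) :
    mulMapLeft S (flipMap S S' X) = S (mulMapRight S' X) := by
  induction X with
  | zero => simp
  | add X Y hX hY => simp only [map_add, hX, hY]
  | tmul b c => simp [hS]

/-- A separability idempotent is invariant under the flip composed with its antipodal maps. -/
theorem flipMap_eq_self {E : B ⊗[ℂ] C} (hEE : E * E = E)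
    (hfullB : Submodule.span ℂ {x : B | ∃ ω : C →ₗ[ℂ] ℂ, x = sL ω E} = ⊤)
    (SB : B ≃ₗ[ℂ] C) (SC : C →ₗ[ℂ] B)
    (hSBanti : ∀ b b' : B, SB (b * b') = SB b' * SB b)
    (hSCanti : ∀ c c' : C, SC (c * c') = SC c' * SC c)
    (hSBrel : ∀ b : B, E * (b ⊗ₜ[ℂ] (1 : C)) = E * ((1 : B) ⊗ₜ[ℂ] SB b))
    (hSCrel : ∀ c : C, ((1 : B) ⊗ₜ[ℂ] c) * E = (SC c ⊗ₜ[ℂ] (1 : C)) * E) :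
    flipMap SB.toLinearMap SC E = E := by
  have hSB1 : SB 1 = 1 := by
    obtain ⟨b, hb⟩ := SB.surjective 1
    simpa [hb] using (hSBanti b 1).symm
  have hE1 : mulMapRight SC E = 1 :=
    eq_one_of_tmul_one_mul_eq_self hfullB
      ((mul_eq_mulMapRight_tmul_one_mul hSCrel E).symm.trans hEE)
  set G := flipMap SB.toLinearMap SC E with hG
  have hGrel (c : C) : ((1 : B) ⊗ₜ[ℂ] c) * G = (SC c ⊗ₜ[ℂ] (1 : C)) * G := by
    obtain ⟨b, rfl⟩ := SB.surjective c
    have h := congrArg (flipMap SB.toLinearMap SC) (hSBrel b)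
    have hSC1 : SC 1 ⊗ₜ[ℂ] (1 : C) * G = G := by
      have h1 := congrArg (flipMap SB.toLinearMap SC) (mul_one E)
      rwa [flipMap_mul hSBanti hSCanti, Algebra.TensorProduct.one_def, flipMap_tmul,
        LinearEquiv.coe_coe, hSB1] at h1
    rw [flipMap_mul hSBanti hSCanti, flipMap_mul hSBanti hSCanti, ← hG, flipMap_tmul,
      flipMap_tmul, LinearEquiv.coe_coe, hSB1] at h
    have h2 : (SC 1 ⊗ₜ[ℂ] SB b) * G = ((1 : B) ⊗ₜ[ℂ] SB b) * (SC 1 ⊗ₜ[ℂ] (1 : C) * G) := by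
      simp [← mul_assoc]
    rw [← h, h2, hSC1]
  have hEG : E * G = E := by
    rw [mul_eq_mul_one_tmul_mulMapLeft (S := SB.toLinearMap) hSBrel, hG,
      mulMapLeft_flipMap hSBanti, hE1, LinearEquiv.coe_coe, hSB1,
      ← Algebra.TensorProduct.one_def, mul_one]
  rw [← hEG, mul_eq_mulMapRight_tmul_one_mul hGrel, hE1, ← Algebra.TensorProduct.one_def, one_mul]

end SeparabilityIdempotent

theorem statement5
    (B C : Type) [Ring B] [Algebra ℂ B] [Ring C] [Algebra ℂ C]
    (E : B ⊗[ℂ] C) (hEE : E * E = E)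
    (hfullB : Submodule.span ℂ {x : B | ∃ ω : C →ₗ[ℂ] ℂ, x = sL ω E} = ⊤)
    (hfullC : Submodule.span ℂ {y : C | ∃ ω : B →ₗ[ℂ] ℂ, y = sR ω E} = ⊤)
    (SB : B ≃ₗ[ℂ] C) (SC : C ≃ₗ[ℂ] B)
    (hSBanti : ∀ b b' : B, SB (b * b') = SB b' * SB b)
    (hSCanti : ∀ c c' : C, SC (c * c') = SC c' * SC c)
    (hSBrel : ∀ b : B, E * (b ⊗ₜ[ℂ] (1 : C)) = E * ((1 : B) ⊗ₜ[ℂ] SB b))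
    (hSCrel : ∀ c : C, ((1 : B) ⊗ₜ[ℂ] c) * E = (SC c ⊗ₜ[ℂ] (1 : C)) * E)
 :
    TensorProduct.map LinearMap.id (TensorProduct.mk ℂ B C 1) E *
        TensorProduct.map LinearMap.id ((TensorProduct.mk ℂ B C).flip 1)
          (TensorProduct.map LinearMap.id SC.toLinearMap E) =
      TensorProduct.map LinearMap.id (TensorProduct.mk ℂ B C 1) E * ((1 : B) ⊗ₜ[ℂ] E) ∧
    TensorProduct.map LinearMap.id ((TensorProduct.mk ℂ B C).flip 1)
          (TensorProduct.map LinearMap.id SB.symm.toLinearMap E) *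
        TensorProduct.map LinearMap.id (TensorProduct.mk ℂ B C 1) E =
      ((1 : B) ⊗ₜ[ℂ] E) * TensorProduct.map LinearMap.id (TensorProduct.mk ℂ B C 1) E ∧
    ((1 : B) ⊗ₜ[ℂ] TensorProduct.map SB.toLinearMap LinearMap.id E) *
        TensorProduct.map LinearMap.id (TensorProduct.mk ℂ C C 1) E =
      TensorProduct.map LinearMap.id ((TensorProduct.mk ℂ C C).flip 1) E *
        TensorProduct.map LinearMap.id (TensorProduct.mk ℂ C C 1) E ∧
    TensorProduct.map LinearMap.id (TensorProduct.mk ℂ C C 1) E *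
        ((1 : B) ⊗ₜ[ℂ] TensorProduct.map SC.symm.toLinearMap LinearMap.id E) =
      TensorProduct.map LinearMap.id (TensorProduct.mk ℂ C C 1) E *
        TensorProduct.map LinearMap.id ((TensorProduct.mk ℂ C C).flip 1) E := by
  have hflip := flipMap_eq_self hEE hfullB SB SC.toLinearMap hSBanti hSCanti hSBrel hSCrel
  refine ⟨?_, ?_, ?_, ?_⟩
  · have key (X : B ⊗[ℂ] C) :
        TensorProduct.map LinearMap.id (TensorProduct.mk ℂ B C 1) E *
          TensorProduct.map LinearMap.id ((TensorProduct.mk ℂ B C).flip 1)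
            (TensorProduct.map LinearMap.id SC.toLinearMap X) =
        TensorProduct.map LinearMap.id (TensorProduct.mk ℂ B C 1) E *
          ((1 : B) ⊗ₜ[ℂ] flipMap SB.toLinearMap SC.toLinearMap X) := by
      induction X with
      | zero => simp
      | add X Y hX hY => simp only [map_add, TensorProduct.tmul_add, mul_add, hX, hY]
      | tmul b c => simpa using map_id_mk_one_mul_exchange (hSBrel b) (SC c)
    simpa only [hflip] using key E
  · have key (X : B ⊗[ℂ] C) :
        TensorProduct.map LinearMap.id ((TensorProduct.mk ℂ B C).flip 1)
            (TensorProduct.map LinearMap.id SB.symm.toLinearMap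
              (flipMap SB.toLinearMap SC.toLinearMap X)) *
          TensorProduct.map LinearMap.id (TensorProduct.mk ℂ B C 1) E =
        ((1 : B) ⊗ₜ[ℂ] X) * TensorProduct.map LinearMap.id (TensorProduct.mk ℂ B C 1) E := by
      induction X with
      | zero => simp
      | add X Y hX hY => simp only [map_add, TensorProduct.tmul_add, add_mul, hX, hY]
      | tmul b c => simpa using (exchange_mul_map_id_mk_one (hSCrel c) b).symm
    simpa only [hflip] using key E
  · have key (X : B ⊗[ℂ] C) :
        ((1 : B) ⊗ₜ[ℂ] TensorProduct.map SB.toLinearMap LinearMap.id X) *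
          TensorProduct.map LinearMap.id (TensorProduct.mk ℂ C C 1) E =
        TensorProduct.map LinearMap.id ((TensorProduct.mk ℂ C C).flip 1)
            (flipMap SB.toLinearMap SC.toLinearMap X) *
          TensorProduct.map LinearMap.id (TensorProduct.mk ℂ C C 1) E := by
      induction X with
      | zero => simp
      | add X Y hX hY => simp only [map_add, TensorProduct.tmul_add, add_mul, hX, hY]
      | tmul b c => simpa using exchange_mul_map_id_mk_one (hSCrel c) (SB b)
    simpa only [hflip] using key E
  · have key (X : B ⊗[ℂ] C) :
        TensorProduct.map LinearMap.id (TensorProduct.mk ℂ C C 1) E *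
          ((1 : B) ⊗ₜ[ℂ] TensorProduct.map SC.symm.toLinearMap LinearMap.id
            (flipMap SB.toLinearMap SC.toLinearMap X)) =
        TensorProduct.map LinearMap.id (TensorProduct.mk ℂ C C 1) E *
          TensorProduct.map LinearMap.id ((TensorProduct.mk ℂ C C).flip 1) X := by
      induction X with
      | zero => simp
      | add X Y hX hY => simp only [map_add, TensorProduct.tmul_add, mul_add, hX, hY]
      | tmul b c => simpa using (map_id_mk_one_mul_exchange (hSBrel b) c).symm
    simpa only [hflip] using key E
end

section
/- Under the standing hypotheses in the context, every left integral φ satisfies φ(y·a) = φ(a·S_B(S_C(y))) for all a ∈ A and y ∈ C, and every right integral ψ satisfies ψ(x·a) = ψ(a·S_B⁻¹(S_C⁻¹(x))) for all a ∈ A and x ∈ B. -/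
open TensorProduct

/-- `u ⊗ v ↦ u ⊗ (v ⊗ 1)`, placing `A ⊗ A` in legs 1 and 2 of the triple tensor product. -/
noncomputable def leg12 (A : Type) [Ring A] [Algebra ℂ A] :
    (A ⊗[ℂ] A) →ₗ[ℂ] A ⊗[ℂ] (A ⊗[ℂ] A) :=
  TensorProduct.map LinearMap.id ((TensorProduct.mk ℂ A A).flip 1)

/-- `u ⊗ v ↦ u ⊗ (1 ⊗ v)`, placing `A ⊗ A` in legs 1 and 3 of the triple tensor product. -/
noncomputable def leg13 (A : Type) [Ring A] [Algebra ℂ A] :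
    (A ⊗[ℂ] A) →ₗ[ℂ] A ⊗[ℂ] (A ⊗[ℂ] A) :=
  TensorProduct.map LinearMap.id (TensorProduct.mk ℂ A A 1)

/-- A left integral: a nonzero functional with `(id ⊗ φ)(Δ a) ∈ C` for all `a`. -/
noncomputable def IsLeftIntegral (A : Type) [Ring A] [Algebra ℂ A] (Δ : A →ₗ[ℂ] A ⊗[ℂ] A)
    (C : Subalgebra ℂ A) (φ : A →ₗ[ℂ] ℂ) : Prop :=
  φ ≠ 0 ∧ ∀ a : A, sL φ (Δ a) ∈ C

/-- A right integral: a nonzero functional with `(ψ ⊗ id)(Δ a) ∈ B` for all `a`. -/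
noncomputable def IsRightIntegral (A : Type) [Ring A] [Algebra ℂ A] (Δ : A →ₗ[ℂ] A ⊗[ℂ] A)
    (B : Subalgebra ℂ A) (ψ : A →ₗ[ℂ] ℂ) : Prop :=
  ψ ≠ 0 ∧ ∀ a : A, sR ψ (Δ a) ∈ B

/-- There is a faithful set of left integrals. -/
noncomputable def FaithfulLeftIntegrals (A : Type) [Ring A] [Algebra ℂ A]
    (Δ : A →ₗ[ℂ] A ⊗[ℂ] A) (C : Subalgebra ℂ A) : Prop :=
  (∀ a : A, (∀ φ : A →ₗ[ℂ] ℂ, IsLeftIntegral A Δ C φ → ∀ b : A, φ (a * b) = 0) → a = 0) ∧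
  (∀ a : A, (∀ φ : A →ₗ[ℂ] ℂ, IsLeftIntegral A Δ C φ → ∀ b : A, φ (b * a) = 0) → a = 0)

/-- There is a faithful set of right integrals. -/
noncomputable def FaithfulRightIntegrals (A : Type) [Ring A] [Algebra ℂ A]
    (Δ : A →ₗ[ℂ] A ⊗[ℂ] A) (B : Subalgebra ℂ A) : Prop :=
  (∀ a : A, (∀ ψ : A →ₗ[ℂ] ℂ, IsRightIntegral A Δ B ψ → ∀ b : A, ψ (a * b) = 0) → a = 0) ∧
  (∀ a : A, (∀ ψ : A →ₗ[ℂ] ℂ, IsRightIntegral A Δ B ψ → ∀ b : A, ψ (b * a) = 0) → a = 0)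

theorem sL_tmul {B C : Type} [AddCommGroup B] [Module ℂ B] [AddCommGroup C] [Module ℂ C]
    (ω : C →ₗ[ℂ] ℂ) (b : B) (c : C) : sL ω (b ⊗ₜ[ℂ] c) = ω c • b := by
  simp [sL]

theorem sR_tmul {B C : Type} [AddCommGroup B] [Module ℂ B] [AddCommGroup C] [Module ℂ C]
    (ω : B →ₗ[ℂ] ℂ) (b : B) (c : C) : sR ω (b ⊗ₜ[ℂ] c) = ω b • c := by
  simp [sR]

theorem apply_sL_eq_apply_sR {B C : Type} [AddCommGroup B] [Module ℂ B] [AddCommGroup C]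
    [Module ℂ C] (f : B →ₗ[ℂ] ℂ) (g : C →ₗ[ℂ] ℂ) (t : B ⊗[ℂ] C) :
    f (sL g t) = g (sR f t) := by
  induction t with
  | zero => simp
  | tmul b c => simp [sL_tmul, sR_tmul, mul_comm]
  | add x y hx hy => simp [hx, hy]

theorem sL_map {B C B' C' : Type} [AddCommGroup B] [Module ℂ B] [AddCommGroup C] [Module ℂ C]
    [AddCommGroup B'] [Module ℂ B'] [AddCommGroup C'] [Module ℂ C']
    (f : B →ₗ[ℂ] B') (g : C →ₗ[ℂ] C') (ω : C' →ₗ[ℂ] ℂ) (t : B ⊗[ℂ] C) :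
    sL ω (TensorProduct.map f g t) = f (sL (ω ∘ₗ g) t) := by
  induction t with
  | zero => simp
  | tmul b c => simp [sL_tmul]
  | add x y hx hy => simp [hx, hy]

theorem sR_map {B C B' C' : Type} [AddCommGroup B] [Module ℂ B] [AddCommGroup C] [Module ℂ C]
    [AddCommGroup B'] [Module ℂ B'] [AddCommGroup C'] [Module ℂ C']
    (f : B →ₗ[ℂ] B') (g : C →ₗ[ℂ] C') (ω : B' →ₗ[ℂ] ℂ) (t : B ⊗[ℂ] C) :
    sR ω (TensorProduct.map f g t) = g (sR (ω ∘ₗ f) t) := by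
  induction t with
  | zero => simp
  | tmul b c => simp [sR_tmul]
  | add x y hx hy => simp [hx, hy]

section Slices

variable {A : Type} [Ring A] [Algebra ℂ A]

theorem sL_tmul_one_mul_s10 (ω : A →ₗ[ℂ] ℂ) (a : A) (t : A ⊗[ℂ] A) :
    sL ω ((a ⊗ₜ[ℂ] (1 : A)) * t) = a * sL ω t := by
  induction t with
  | zero => simp
  | tmul b c => simp [sL_tmul]
  | add x y hx hy => simp [mul_add, hx, hy]

theorem sL_mul_tmul_one (ω : A →ₗ[ℂ] ℂ) (a : A) (t : A ⊗[ℂ] A) :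
    sL ω (t * (a ⊗ₜ[ℂ] (1 : A))) = sL ω t * a := by
  induction t with
  | zero => simp
  | tmul b c => simp [sL_tmul]
  | add x y hx hy => simp [add_mul, hx, hy]

theorem sR_one_tmul_mul (ω : A →ₗ[ℂ] ℂ) (a : A) (t : A ⊗[ℂ] A) :
    sR ω (((1 : A) ⊗ₜ[ℂ] a) * t) = a * sR ω t := by
  induction t with
  | zero => simp
  | tmul b c => simp [sR_tmul]
  | add x y hx hy => simp [mul_add, hx, hy]

theorem sR_mul_one_tmul (ω : A →ₗ[ℂ] ℂ) (a : A) (t : A ⊗[ℂ] A) :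
    sR ω (t * ((1 : A) ⊗ₜ[ℂ] a)) = sR ω t * a := by
  induction t with
  | zero => simp
  | tmul b c => simp [sR_tmul]
  | add x y hx hy => simp [add_mul, hx, hy]

theorem sL_one_tmul_mul (ω : A →ₗ[ℂ] ℂ) (a : A) (t : A ⊗[ℂ] A) :
    sL ω (((1 : A) ⊗ₜ[ℂ] a) * t) = sL (ω ∘ₗ LinearMap.mulLeft ℂ a) t := by
  induction t with
  | zero => simp
  | tmul b c => simp [sL_tmul]
  | add x y hx hy => simp [mul_add, hx, hy]

theorem sL_mul_one_tmul (ω : A →ₗ[ℂ] ℂ) (a : A) (t : A ⊗[ℂ] A) :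
    sL ω (t * ((1 : A) ⊗ₜ[ℂ] a)) = sL (ω ∘ₗ LinearMap.mulRight ℂ a) t := by
  induction t with
  | zero => simp
  | tmul b c => simp [sL_tmul]
  | add x y hx hy => simp [add_mul, hx, hy]

theorem sR_tmul_one_mul (ω : A →ₗ[ℂ] ℂ) (a : A) (t : A ⊗[ℂ] A) :
    sR ω ((a ⊗ₜ[ℂ] (1 : A)) * t) = sR (ω ∘ₗ LinearMap.mulLeft ℂ a) t := by
  induction t with
  | zero => simp
  | tmul b c => simp [sR_tmul]
  | add x y hx hy => simp [mul_add, hx, hy]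

theorem sR_mul_tmul_one (ω : A →ₗ[ℂ] ℂ) (a : A) (t : A ⊗[ℂ] A) :
    sR ω (t * (a ⊗ₜ[ℂ] (1 : A))) = sR (ω ∘ₗ LinearMap.mulRight ℂ a) t := by
  induction t with
  | zero => simp
  | tmul b c => simp [sR_tmul]
  | add x y hx hy => simp [add_mul, hx, hy]

theorem sL_sR_leg12_mul (f g : A →ₗ[ℂ] ℂ) (s t : A ⊗[ℂ] A) :
    sL g (sR f (leg12 A s * ((1 : A) ⊗ₜ[ℂ] t))) = sR f s * sL g t := by
  induction s with
  | zero => simp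
  | tmul a b =>
    induction t with
    | zero => simp
    | tmul c d => simp [leg12, sL_tmul, sR_tmul, smul_comm (f a)]
    | add x y hx hy => simp [mul_add, TensorProduct.tmul_add, hx, hy]
  | add x y hx hy => simp [add_mul, hx, hy]

theorem sL_sR_mul_leg12 (f g : A →ₗ[ℂ] ℂ) (s t : A ⊗[ℂ] A) :
    sL g (sR f (((1 : A) ⊗ₜ[ℂ] t) * leg12 A s)) = sL g t * sR f s := by
  induction s with
  | zero => simp
  | tmul a b =>
    induction t with
    | zero => simp
    | tmul c d => simp [leg12, sL_tmul, sR_tmul]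
    | add x y hx hy => simp [add_mul, TensorProduct.tmul_add, hx, hy]
  | add x y hx hy => simp [mul_add, hx, hy]

/-- Functionals agreeing after slicing the right leg of a full coproduct are equal. -/
theorem eq_of_sL_comp_eq {Δ : A →ₗ[ℂ] A ⊗[ℂ] A}
    (hfull : Submodule.span ℂ {x : A | ∃ ω : A →ₗ[ℂ] ℂ, ∃ a : A, x = sR ω (Δ a)} = ⊤)
    {f g : A →ₗ[ℂ] ℂ} (h : ∀ a, sL f (Δ a) = sL g (Δ a)) : f = g := by
  refine LinearMap.ext_on hfull ?_
  rintro _ ⟨ω, a, rfl⟩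
  rw [← apply_sL_eq_apply_sR, ← apply_sL_eq_apply_sR, h]

/-- Functionals agreeing after slicing the left leg of a full coproduct are equal. -/
theorem eq_of_sR_comp_eq {Δ : A →ₗ[ℂ] A ⊗[ℂ] A}
    (hfull : Submodule.span ℂ {x : A | ∃ ω : A →ₗ[ℂ] ℂ, ∃ a : A, x = sL ω (Δ a)} = ⊤)
    {f g : A →ₗ[ℂ] ℂ} (h : ∀ a, sR f (Δ a) = sR g (Δ a)) : f = g := by
  refine LinearMap.ext_on hfull ?_
  rintro _ ⟨ω, a, rfl⟩
  rw [apply_sL_eq_apply_sR, apply_sL_eq_apply_sR, h]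

/-- If `E ⊗ 1` and `1 ⊗ E` commute, then the two legs of `E` commute. -/
theorem commute_of_leg12_commute {E : A ⊗[ℂ] A}
    (hE : leg12 A E * ((1 : A) ⊗ₜ[ℂ] E) = ((1 : A) ⊗ₜ[ℂ] E) * leg12 A E)
    {B C : Subalgebra ℂ A} {E' : ↥B ⊗[ℂ] ↥C}
    (hE'E : TensorProduct.map B.val.toLinearMap C.val.toLinearMap E' = E)
    (hfullB : Submodule.span ℂ {x : ↥B | ∃ ω : ↥C →ₗ[ℂ] ℂ, x = sL ω E'} = ⊤)
    (hfullC : Submodule.span ℂ {y : ↥C | ∃ ω : ↥B →ₗ[ℂ] ℂ, y = sR ω E'} = ⊤)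
    (b : ↥B) (c : ↥C) : (c : A) * (b : A) = (b : A) * (c : A) := by
  have key : (LinearMap.mul ℂ A).compl₁₂ C.val.toLinearMap B.val.toLinearMap =
      (LinearMap.mul ℂ A).flip.compl₁₂ C.val.toLinearMap B.val.toLinearMap := by
    refine LinearMap.ext_on hfullC ?_
    rintro _ ⟨f, rfl⟩
    refine LinearMap.ext_on hfullB ?_
    rintro _ ⟨g, rfl⟩
    obtain ⟨f', rfl⟩ := LinearMap.exists_extend (p := Subalgebra.toSubmodule B) f
    obtain ⟨g', rfl⟩ := LinearMap.exists_extend (p := Subalgebra.toSubmodule C) g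
    have h := congrArg (fun t => sL g' (sR f' t)) hE
    simp only [sL_sR_leg12_mul, sL_sR_mul_leg12, ← hE'E, sL_map, sR_map] at h
    exact h
  exact LinearMap.congr_fun₂ key c b

end Slices


theorem statement10
    (A : Type) [Ring A] [Algebra ℂ A]
    (Δ : A →ₗ[ℂ] A ⊗[ℂ] A)
    (hΔmul : ∀ a a' : A, Δ (a * a') = Δ a * Δ a')
    (hΔcoassoc : ∀ a : A,
      TensorProduct.assoc ℂ A A A (LinearMap.rTensor A Δ (Δ a)) = LinearMap.lTensor A Δ (Δ a))
    (hΔfullL : Submodule.span ℂ {x : A | ∃ ω : A →ₗ[ℂ] ℂ, ∃ a : A, x = sL ω (Δ a)} = ⊤)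
    (hΔfullR : Submodule.span ℂ {x : A | ∃ ω : A →ₗ[ℂ] ℂ, ∃ a : A, x = sR ω (Δ a)} = ⊤)
    (E : A ⊗[ℂ] A)
    (hEE : E * E = E)
    (hEΔ : ∀ a : A, E * Δ a = Δ a ∧ Δ a * E = Δ a)
    (hranL : (Submodule.span ℂ {y : A ⊗[ℂ] A | ∃ a z, y = Δ a * z} : Set (A ⊗[ℂ] A)) =
      {y : A ⊗[ℂ] A | ∃ z, y = E * z})
    (hranR : (Submodule.span ℂ {y : A ⊗[ℂ] A | ∃ a z, y = z * Δ a} : Set (A ⊗[ℂ] A)) =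
      {y : A ⊗[ℂ] A | ∃ z, y = z * E})
    (hΔE1 : TensorProduct.assoc ℂ A A A (LinearMap.rTensor A Δ E) =
      leg12 A E * ((1 : A) ⊗ₜ[ℂ] E))
    (hΔE2 : leg12 A E * ((1 : A) ⊗ₜ[ℂ] E) = ((1 : A) ⊗ₜ[ℂ] E) * leg12 A E)
    (B C : Subalgebra ℂ A)
    (E' : ↥B ⊗[ℂ] ↥C)
    (hE'E : TensorProduct.map B.val.toLinearMap C.val.toLinearMap E' = E)
    (hE'full1 : Submodule.span ℂ {x : ↥B | ∃ ω : ↥C →ₗ[ℂ] ℂ, x = sL ω E'} = ⊤)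
    (hE'full2 : Submodule.span ℂ {y : ↥C | ∃ ω : ↥B →ₗ[ℂ] ℂ, y = sR ω E'} = ⊤)
    (SB : ↥B ≃ₗ[ℂ] ↥C) (SC : ↥C ≃ₗ[ℂ] ↥B)
    (hSBanti : ∀ b b' : ↥B, SB (b * b') = SB b' * SB b)
    (hSCanti : ∀ c c' : ↥C, SC (c * c') = SC c' * SC c)
    (hSBrel : ∀ b : ↥B, E' * (b ⊗ₜ[ℂ] (1 : ↥C)) = E' * ((1 : ↥B) ⊗ₜ[ℂ] SB b))
    (hSCrel : ∀ c : ↥C, ((1 : ↥B) ⊗ₜ[ℂ] c) * E' = (SC c ⊗ₜ[ℂ] (1 : ↥C)) * E')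
 :
    (∀ φ : A →ₗ[ℂ] ℂ, IsLeftIntegral A Δ C φ → ∀ a : A, ∀ y : ↥C,
      φ ((y : A) * a) = φ (a * ((SB (SC y) : ↥C) : A))) ∧
    (∀ ψ : A →ₗ[ℂ] ℂ, IsRightIntegral A Δ B ψ → ∀ a : A, ∀ x : ↥B,
      ψ ((x : A) * a) = ψ (a * ((SB.symm (SC.symm x) : ↥B) : A))) := by
  have hcomm := commute_of_leg12_commute hΔE2 hE'E hE'full1 hE'full2
  have hB (b : ↥B) (a : A) :
      Δ a * ((b : A) ⊗ₜ[ℂ] (1 : A)) = Δ a * ((1 : A) ⊗ₜ[ℂ] (SB b : A)) := by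
    have h := congrArg (Algebra.TensorProduct.map B.val C.val) (hSBrel b)
    simp only [map_mul, Algebra.TensorProduct.map_tmul, map_one] at h
    change TensorProduct.map B.val.toLinearMap C.val.toLinearMap E' * _ =
      TensorProduct.map B.val.toLinearMap C.val.toLinearMap E' * _ at h
    rw [hE'E] at h
    rw [← (hEΔ a).2, mul_assoc, mul_assoc]
    exact congrArg (Δ a * ·) h
  have hC (c : ↥C) (a : A) :
      ((1 : A) ⊗ₜ[ℂ] (c : A)) * Δ a = ((SC c : A) ⊗ₜ[ℂ] (1 : A)) * Δ a := by
    have h := congrArg (Algebra.TensorProduct.map B.val C.val) (hSCrel c)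
    simp only [map_mul, Algebra.TensorProduct.map_tmul, map_one] at h
    change _ * TensorProduct.map B.val.toLinearMap C.val.toLinearMap E' =
      _ * TensorProduct.map B.val.toLinearMap C.val.toLinearMap E' at h
    rw [hE'E] at h
    rw [← (hEΔ a).1, ← mul_assoc, ← mul_assoc]
    exact congrArg (· * Δ a) h
  refine ⟨fun φ hφ a y => ?_, fun ψ hψ a x => ?_⟩
  · have h : φ ∘ₗ LinearMap.mulLeft ℂ (y : A) =
        φ ∘ₗ LinearMap.mulRight ℂ (SB (SC y) : A) := by
      refine eq_of_sL_comp_eq hΔfullR fun a => ?_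
      rw [← sL_one_tmul_mul, ← sL_mul_one_tmul, hC, ← hB, sL_tmul_one_mul_s10, sL_mul_tmul_one]
      exact (hcomm (SC y) ⟨_, hφ.2 a⟩).symm
    exact LinearMap.congr_fun h a
  · have h : ψ ∘ₗ LinearMap.mulLeft ℂ (x : A) =
        ψ ∘ₗ LinearMap.mulRight ℂ (SB.symm (SC.symm x) : A) := by
      refine eq_of_sR_comp_eq hΔfullL fun a => ?_
      have hx := hC (SC.symm x) a
      rw [LinearEquiv.apply_symm_apply] at hx
      rw [← sR_tmul_one_mul, ← sR_mul_tmul_one, ← hx, hB, LinearEquiv.apply_symm_apply,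
        sR_one_tmul_mul, sR_mul_one_tmul]
      exact hcomm ⟨_, hψ.2 a⟩ (SC.symm x)
    exact LinearMap.congr_fun h a
end
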